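/- Let p be holomorphic on the open unit disc 𝔻 with Re p(z) > 0 for all z ∈ 𝔻, and let F(z) = Log p(z) (principal branch of the logarithm composed with p), which is holomorphic on 𝔻, with Taylor expansion F(z) = a₀ + ∑_{n≥1} a_n zⁿ. Then ∑_{n=1}^{∞} |a_n|² ≤ π²/2. In particular, F belongs to the Hardy space H² of the disc. -/

import Mathlib

open Filter Set

/-- The integral mean `I_p(r) = ∫₀^{2π} |z p'(z)/p(z)|² dθ`, `z = r e^{iθ}`. -/
noncomputable def Ip (p : ℂ → ℂ) (r : ℝ) : ℝ :=
  ∫ θ in (0:ℝ)..(2 * Real.pi),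
    ‖(↑r * Complex.exp (↑θ * Complex.I)) * deriv p (↑r * Complex.exp (↑θ * Complex.I)) /
      p (↑r * Complex.exp (↑θ * Complex.I))‖ ^ 2

/-- Orthogonality of the characters of the circle. -/
theorem integral_exp_int_mul_I (k : ℤ) :
    ∫ θ in (0:ℝ)..(2 * Real.pi), Complex.exp (k * θ * Complex.I) =
      if k = 0 then 2 * (Real.pi : ℂ) else 0 := by
  split_ifs with h
  · simp [h]
  · have hc : (k : ℂ) * Complex.I ≠ 0 := by simp [h]
    have hcongr : ∀ θ : ℝ, Complex.exp (k * θ * Complex.I) =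
        Complex.exp ((k * Complex.I) * θ) := fun θ => by ring_nf
    simp_rw [hcongr]
    rw [integral_exp_mul_complex hc]
    have h1 : (k : ℂ) * Complex.I * ((2 * Real.pi : ℝ) : ℂ) = k * (2 * Real.pi * Complex.I) := by
      push_cast; ring
    rw [h1, Complex.exp_int_mul_two_pi_mul_I]
    simp

/-- Parseval's identity for trigonometric polynomials with nonnegative frequencies. -/
theorem integral_trigPoly_mul_conj (b : ℕ → ℂ) (N : ℕ) :
    ∫ θ in (0:ℝ)..(2 * Real.pi),
        (∑ n ∈ Finset.range N, b n * Complex.exp (n * θ * Complex.I)) *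
        (starRingEnd ℂ) (∑ n ∈ Finset.range N, b n * Complex.exp (n * θ * Complex.I)) =
      2 * Real.pi * ∑ n ∈ Finset.range N, ((‖b n‖ ^ 2 : ℝ) : ℂ) := by
  have hexpand : ∀ θ : ℝ,
      (∑ n ∈ Finset.range N, b n * Complex.exp (n * θ * Complex.I)) *
        (starRingEnd ℂ) (∑ n ∈ Finset.range N, b n * Complex.exp (n * θ * Complex.I)) =
      ∑ m ∈ Finset.range N, ∑ n ∈ Finset.range N, (b m * (starRingEnd ℂ) (b n)) *
        Complex.exp (((m - n : ℤ) : ℂ) * θ * Complex.I) := fun θ => by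
    rw [map_sum, Finset.sum_mul_sum]
    refine Finset.sum_congr rfl fun m _ => Finset.sum_congr rfl fun n _ => ?_
    rw [map_mul, ← Complex.exp_conj, mul_mul_mul_comm, ← Complex.exp_add]
    congr 2
    simp
    ring
  simp_rw [hexpand]
  rw [intervalIntegral.integral_finsetSum
    fun m _ => Continuous.intervalIntegrable (by fun_prop) _ _, Finset.mul_sum]
  refine Finset.sum_congr rfl fun m hm => ?_
  rw [intervalIntegral.integral_finsetSum
    fun m _ => Continuous.intervalIntegrable (by fun_prop) _ _]
  simp_rw [intervalIntegral.integral_const_mul, integral_exp_int_mul_I, sub_eq_zero,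
    Nat.cast_inj, mul_ite, mul_zero]
  rw [Finset.sum_ite_eq, if_pos hm, Complex.mul_conj, Complex.normSq_eq_norm_sq]
  ring

/-- The mean of the square of an analytic trigonometric polynomial. -/
theorem integral_trigPoly_sq (b : ℕ → ℂ) (N : ℕ) :
    ∫ θ in (0:ℝ)..(2 * Real.pi),
        (∑ n ∈ Finset.range (N + 1), b n * Complex.exp (n * θ * Complex.I)) ^ 2 =
      2 * Real.pi * b 0 ^ 2 := by
  have hexpand : ∀ θ : ℝ,
      (∑ n ∈ Finset.range (N + 1), b n * Complex.exp (n * θ * Complex.I)) ^ 2 =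
      ∑ m ∈ Finset.range (N + 1), ∑ n ∈ Finset.range (N + 1), (b m * b n) *
        Complex.exp (((m + n : ℤ) : ℂ) * θ * Complex.I) := fun θ => by
    rw [sq, Finset.sum_mul_sum]
    refine Finset.sum_congr rfl fun m _ => Finset.sum_congr rfl fun n _ => ?_
    rw [mul_mul_mul_comm, ← Complex.exp_add]
    congr 2
    push_cast
    ring
  simp_rw [hexpand]
  rw [intervalIntegral.integral_finsetSum
    fun m _ => Continuous.intervalIntegrable (by fun_prop) _ _]
  have hinner : ∀ m ∈ Finset.range (N + 1),
      (∫ θ in (0:ℝ)..(2 * Real.pi), ∑ n ∈ Finset.range (N + 1), (b m * b n) *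
        Complex.exp (((m + n : ℤ) : ℂ) * θ * Complex.I)) =
      if m = 0 then 2 * Real.pi * b 0 ^ 2 else 0 := fun m _ => by
    rw [intervalIntegral.integral_finsetSum
      fun m _ => Continuous.intervalIntegrable (by fun_prop) _ _]
    simp_rw [intervalIntegral.integral_const_mul, integral_exp_int_mul_I]
    have hz : ∀ n : ℕ, ((m : ℤ) + n = 0) ↔ (m = 0 ∧ n = 0) := fun n => by omega
    simp_rw [hz]
    split_ifs with hm
    · subst hm
      simp
      ring
    · simp [hm]
  rw [Finset.sum_congr rfl hinner]
  simp

/-- If the imaginary part of an analytic trigonometric polynomial is bounded by `c`, then the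
sum of squares of its nonconstant coefficients is at most `2 c²`. -/
theorem sum_norm_sq_le_of_abs_im_le (b : ℕ → ℂ) (N : ℕ) {c : ℝ}
    (hc : ∀ θ : ℝ,
      |(∑ n ∈ Finset.range (N + 1), b n * Complex.exp (n * θ * Complex.I)).im| ≤ c) :
    ∑ n ∈ Finset.range N, ‖b (n + 1)‖ ^ 2 ≤ 2 * c ^ 2 := by
  set S : ℝ → ℂ := fun θ => ∑ n ∈ Finset.range (N + 1), b n * Complex.exp (n * θ * Complex.I)
    with hS
  have hScont : Continuous S := by fun_prop
  have hconj : Continuous fun θ => S θ * (starRingEnd ℂ) (S θ) :=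
    hScont.mul (Complex.continuous_conj.comp hScont)
  have hsq : Continuous fun θ => S θ ^ 2 := hScont.pow 2
  have hdiff : ∫ θ in (0:ℝ)..(2 * Real.pi), (S θ * (starRingEnd ℂ) (S θ) - S θ ^ 2) =
      2 * Real.pi * ∑ n ∈ Finset.range (N + 1), ((‖b n‖ ^ 2 : ℝ) : ℂ)
        - 2 * Real.pi * b 0 ^ 2 := by
    rw [intervalIntegral.integral_sub (hconj.intervalIntegrable _ _)
      (hsq.intervalIntegrable _ _), integral_trigPoly_mul_conj,
      integral_trigPoly_sq]
  have hre := congrArg Complex.re hdiff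
  have hcomm : (∫ θ in (0:ℝ)..(2 * Real.pi), (S θ * (starRingEnd ℂ) (S θ) - S θ ^ 2)).re =
      ∫ θ in (0:ℝ)..(2 * Real.pi), (S θ * (starRingEnd ℂ) (S θ) - S θ ^ 2).re :=
    (Complex.reCLM.intervalIntegral_comp_comm
      ((hconj.sub hsq).intervalIntegrable _ _)).symm
  have hpoint : ∀ θ, (S θ * (starRingEnd ℂ) (S θ) - S θ ^ 2).re = 2 * (S θ).im ^ 2 := fun θ => by
    simp [sq]
    ring
  have hle : ∫ θ in (0:ℝ)..(2 * Real.pi), 2 * (S θ).im ^ 2 ≤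
      ∫ _ in (0:ℝ)..(2 * Real.pi), 2 * c ^ 2 := by
    refine intervalIntegral.integral_mono_on Real.two_pi_pos.le
      (Continuous.intervalIntegrable
        (continuous_const.mul ((Complex.continuous_im.comp hScont).pow 2)) _ _)
      (by simp) fun θ _ => ?_
    have := sq_le_sq' (abs_le.mp (hc θ)).1 (abs_le.mp (hc θ)).2
    linarith
  rw [hcomm] at hre
  simp_rw [hpoint] at hre
  rw [hre, intervalIntegral.integral_const, Finset.sum_range_succ'] at hle
  have hcalc : (2 * (Real.pi : ℂ) * (∑ n ∈ Finset.range N, ((‖b (n + 1)‖ ^ 2 : ℝ) : ℂ)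
      + ((‖b 0‖ ^ 2 : ℝ) : ℂ)) - 2 * Real.pi * b 0 ^ 2).re =
      2 * Real.pi * (∑ n ∈ Finset.range N, ‖b (n + 1)‖ ^ 2 + 2 * (b 0).im ^ 2) := by
    rw [← Complex.ofReal_sum, ← Complex.normSq_eq_norm_sq, Complex.normSq_apply]
    simp [sq]
    ring
  rw [hcalc, smul_eq_mul, sub_zero] at hle
  have := le_of_mul_le_mul_left hle Real.two_pi_pos
  nlinarith [sq_nonneg (b 0).im]

/-- If `f(z) = ∑ a n zⁿ` on the unit disc has imaginary part bounded by `c`, then the partial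
sums of `‖a n‖²`, `n ≥ 1`, are at most `2 c²`. -/
theorem sum_norm_sq_coeff_le {f : ℂ → ℂ} {a : ℕ → ℂ} {c : ℝ}
    (ha : ∀ z ∈ Metric.ball (0:ℂ) 1, HasSum (fun n : ℕ => a n * z ^ n) (f z))
    (hc : ∀ z ∈ Metric.ball (0:ℂ) 1, |(f z).im| ≤ c) (M : ℕ) :
    ∑ n ∈ Finset.range M, ‖a (n + 1)‖ ^ 2 ≤ 2 * c ^ 2 := by
  have hr : ∀ r ∈ Ioo (0:ℝ) 1,
      ∑ n ∈ Finset.range M, ‖a (n + 1) * (r : ℂ) ^ (n + 1)‖ ^ 2 ≤ 2 * c ^ 2 := by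
    intro r hr
    have hε : ∀ ε > 0, ∑ n ∈ Finset.range M, ‖a (n + 1) * (r : ℂ) ^ (n + 1)‖ ^ 2 ≤
        2 * (c + ε) ^ 2 := by
      intro ε hε
      have hsum : Summable fun n : ℕ => ‖a n * (r : ℂ) ^ n‖ :=
        (ha r (by simp [abs_of_pos hr.1, hr.2])).summable.norm
      have hunif := tendstoUniformly_tsum_nat
        (f := fun n (θ : ℝ) => a n * (r : ℂ) ^ n * Complex.exp (n * θ * Complex.I)) hsum
        (fun n θ => by
          rw [norm_mul _ (Complex.exp _)]
          have : (n : ℂ) * θ * Complex.I = ((n * θ : ℝ) : ℂ) * Complex.I := by push_cast; ring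
          rw [this, Complex.norm_exp_ofReal_mul_I, mul_one])
      rw [Metric.tendstoUniformly_iff] at hunif
      obtain ⟨N, hN, hMN⟩ := (((tendsto_add_atTop_nat 1).eventually (hunif ε hε)).and
        (eventually_ge_atTop M)).exists
      refine (Finset.sum_le_sum_of_subset_of_nonneg (Finset.range_mono hMN)
        fun _ _ _ => by positivity).trans
          (sum_norm_sq_le_of_abs_im_le (fun n => a n * (r : ℂ) ^ n) N fun θ => ?_)
      have hz : (r : ℂ) * Complex.exp (θ * Complex.I) ∈ Metric.ball (0:ℂ) 1 := by
        simp [Complex.norm_exp_ofReal_mul_I, abs_of_pos hr.1, hr.2]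
      have hf : ∑' n : ℕ, a n * (r : ℂ) ^ n * Complex.exp (n * θ * Complex.I) =
          f (r * Complex.exp (θ * Complex.I)) := by
        rw [← (ha _ hz).tsum_eq]
        refine tsum_congr fun n => ?_
        rw [mul_pow, ← Complex.exp_nat_mul]
        ring_nf
      have hdist := hN θ
      rw [hf, dist_comm, dist_eq_norm] at hdist
      have h1 := (Complex.abs_im_le_norm _).trans hdist.le
      rw [Complex.sub_im] at h1
      have h2 := hc _ hz
      rw [abs_le] at h1 h2 ⊢
      constructor <;> linarith [h1.1, h1.2, h2.1, h2.2]
    have hlim : Tendsto (fun ε : ℝ => 2 * (c + ε) ^ 2) (nhdsWithin 0 (Ioi 0))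
        (nhds (2 * c ^ 2)) := by
      have : Continuous fun ε : ℝ => 2 * (c + ε) ^ 2 := by fun_prop
      simpa using (this.tendsto 0).mono_left nhdsWithin_le_nhds
    exact ge_of_tendsto hlim (eventually_nhdsWithin_of_forall hε)
  have hlim : Tendsto
      (fun r : ℝ => ∑ n ∈ Finset.range M, ‖a (n + 1) * (r : ℂ) ^ (n + 1)‖ ^ 2)
      (nhdsWithin 1 (Iio 1)) (nhds (∑ n ∈ Finset.range M, ‖a (n + 1)‖ ^ 2)) := by
    have : Continuous fun r : ℝ =>
        ∑ n ∈ Finset.range M, ‖a (n + 1) * (r : ℂ) ^ (n + 1)‖ ^ 2 := by fun_prop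
    simpa using (this.tendsto 1).mono_left nhdsWithin_le_nhds
  refine le_of_tendsto hlim ?_
  filter_upwards [Ioo_mem_nhdsLT (zero_lt_one' ℝ)] with r h using hr r h

/-- The `H²`-estimate: if `F = Log p` for a Carathéodory function `p` has Taylor
coefficients `a n`, then `∑_{n≥1} |a_n|² ≤ π²/2`; in particular the coefficient
sequence is square-summable, i.e. `F ∈ H²`. -/
theorem stmt5 (p : ℂ → ℂ)
    (hp : DifferentiableOn ℂ p (Metric.ball (0:ℂ) 1))
    (hre : ∀ z ∈ Metric.ball (0:ℂ) 1, 0 < (p z).re)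
    (a : ℕ → ℂ)
    (ha : ∀ z ∈ Metric.ball (0:ℂ) 1, HasSum (fun n : ℕ => a n * z ^ n) (Complex.log (p z))) :
    Summable (fun n : ℕ => ‖a (n + 1)‖ ^ 2) ∧
    (∑' n : ℕ, ‖a (n + 1)‖ ^ 2) ≤ Real.pi ^ 2 / 2 ∧
    Summable (fun n : ℕ => ‖a n‖ ^ 2) := by
  have hbound : ∀ M, ∑ n ∈ Finset.range M, ‖a (n + 1)‖ ^ 2 ≤ Real.pi ^ 2 / 2 := fun M => by
    have h := sum_norm_sq_coeff_le ha (c := Real.pi / 2) (fun z hz => by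
      rw [Complex.log_im, Complex.abs_arg_le_pi_div_two_iff]
      exact (hre z hz).le) M
    linarith
  have hsum : Summable fun n : ℕ => ‖a (n + 1)‖ ^ 2 :=
    summable_of_sum_range_le (fun _ => by positivity) hbound
  exact ⟨hsum, Real.tsum_le_of_sum_range_le (fun _ => by positivity) hbound,
    (summable_nat_add_iff (f := fun n => ‖a n‖ ^ 2) 1).mp hsum⟩
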